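/- arXiv:2111.00863 — 2 statements merged into one kernel-verified Lean document; each statement's English description precedes it below -/
import Mathlib

section
/- For every finite word w of length n, the number of distinct closed factors of w of length at least 2 is at most n²/6 + n/6; consequently the total number of distinct closed factors of w is at most n²/6 + 7n/6 + 1. -/
open List

variable {α : Type*}

/-- Number of occurrences of `u` as a factor of `w` (by starting position). -/
def occCount [DecidableEq α] (u w : List α) : ℕ :=
  ((Finset.range (w.length + 1)).filter
    (fun i => i + u.length ≤ w.length ∧ (w.drop i).take u.length = u)).card

/-- A finite word is closed if it has length ≤ 1 or it has a border occurring
exactly twice in it (as prefix and as suffix). -/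
def ClosedWord [DecidableEq α] (w : List α) : Prop :=
  w.length ≤ 1 ∨ ∃ k ∈ Finset.Ioo 0 w.length,
    (w.take k) <:+ w ∧ occCount (w.take k) w = 2

instance [DecidableEq α] (w : List α) : Decidable (ClosedWord w) := by
  unfold ClosedWord; infer_instance

/-- The finite set of distinct closed factors of `w`. -/
def closedFactors [DecidableEq α] (w : List α) : Finset (List α) :=
  (w.inits.flatMap List.tails).toFinset.filter ClosedWord

/-- The number of distinct closed factors of `w`. -/
def clCount [DecidableEq α] (w : List α) : ℕ := (closedFactors w).card

/-- `t` is a period of the finite word `w`. -/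
def HasPeriod (w : List α) (t : ℕ) : Prop := 0 < t ∧ w.drop t <+: w

/-- Factor of the infinite word `w` starting at `i` of length `m`. -/
def factorAt (w : ℕ → α) (i m : ℕ) : List α := (List.range m).map (fun j => w (i + j))

/-- `u` occurs in the infinite word `w` at position `i`. -/
def occursAt (w : ℕ → α) (u : List α) (i : ℕ) : Prop := factorAt w i u.length = u

/-- An infinite word is aperiodic if it is not eventually periodic. -/
def Aperiodic' (w : ℕ → α) : Prop := ¬ ∃ p, 0 < p ∧ ∃ N, ∀ n ≥ N, w (n + p) = w n

/-- A finite word is primitive if it is not an integer power of a shorter word. -/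
def Primitive (u : List α) : Prop :=
  u ≠ [] ∧ ∀ (v : List α) (k : ℕ), 2 ≤ k → u ≠ (List.replicate k v).flatten

/-- The number of distinct closed factors of length at least 2. -/
def clCount' [DecidableEq α] (w : List α) : ℕ :=
  ((closedFactors w).filter (fun u => 2 ≤ u.length)).card

namespace CF

/-- `v` occurs in `w` at position `i`. -/
def At (w v : List α) (i : ℕ) : Prop := ∀ k, k < v.length → w[i + k]? = v[k]?

theorem At.bound {w v : List α} {i : ℕ} (h : At w v i) (hv : v ≠ []) :
    i + v.length ≤ w.length := by
  have hl : 0 < v.length := List.length_pos_iff.mpr hv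
  have h1 := h (v.length - 1) (by omega)
  rw [List.getElem?_eq_getElem (by omega : v.length - 1 < v.length)] at h1
  obtain ⟨h2, _⟩ := List.getElem?_eq_some_iff.mp h1
  omega

theorem At.trans {w u v : List α} {i j : ℕ} (h : At w u i) (h' : At u v j) :
    At w v (i + j) := by
  intro k hk
  have h1 := h' k hk
  have h2 := h1
  rw [List.getElem?_eq_getElem hk] at h2
  obtain ⟨h3, _⟩ := List.getElem?_eq_some_iff.mp h2
  rw [add_assoc, h _ h3, h1]

theorem At.restrict {w u v : List α} {i j s : ℕ} (h : At w u i) (h' : At w v s)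
    (hs : s = i + j) (hj : j + v.length ≤ u.length) : At u v j := by
  intro k hk
  subst hs
  rw [← h' k hk, ← h (j + k) (by omega), add_assoc]

theorem At.eq {w u v : List α} {i : ℕ} (h : At w u i) (h' : At w v i)
    (hl : u.length = v.length) : u = v := by
  apply List.ext_getElem? 
  intro k
  by_cases hk : k < u.length
  · rw [← h k hk, ← h' k (by omega)]
  · rw [List.getElem?_eq_none (by omega), List.getElem?_eq_none (by omega)]

def fac (w : List α) (i k : ℕ) : List α := (w.drop i).take k

theorem fac_length {w : List α} {i k : ℕ} (h : i + k ≤ w.length) : (fac w i k).length = k := by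
  simp [fac]; omega

theorem fac_at {w : List α} {i k : ℕ} : At w (fac w i k) i := by
  intro t ht
  have : t < k := by simp [fac] at ht; omega
  simp [fac, this]

/-- proper border -/
def Bd (v x : List α) : Prop := v.length < x.length ∧ At x v 0 ∧ At x v (x.length - v.length)

/-- longest nonempty border -/
def LB (v x : List α) : Prop := v ≠ [] ∧ Bd v x ∧ ∀ b, Bd b x → b.length ≤ v.length

/-- complete return -/
def R (v x : List α) : Prop :=
  v ≠ [] ∧ Bd v x ∧ ∀ s, At x v s → s = 0 ∨ s = x.length - v.length

theorem LB.unique {v v' x : List α} (h : LB v x) (h' : LB v' x) : v = v' :=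
  h.2.1.2.1.eq h'.2.1.2.1 (le_antisymm (h'.2.2 _ h.2.1) (h.2.2 _ h'.2.1))

theorem R.lb {v x : List α} (h : R v x) : LB v x := by
  refine ⟨h.1, h.2.1, ?_⟩
  intro b hb
  by_contra hlt
  push Not at hlt
  have hb1 := hb.1
  have h1 : At x v (x.length - v.length) := h.2.1.2.2
  have h2 : At b v (b.length - v.length) :=
    hb.2.2.restrict (j := b.length - v.length) h1 (by omega) (by omega)
  have h3 := hb.2.1.trans h2
  rcases h.2.2 _ h3 with h4 | h4 <;> omega

theorem R.ne {v x : List α} (h : R v x) : x ≠ [] := by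
  intro hx
  have := h.2.1.1
  simp [hx] at this

/-- next occurrence -/
theorem R.next {w v c : List α} {i s : ℕ} (h : R v c) (hc : At w c i) (hs : At w v s)
    (his : i < s) : i + c.length ≤ s + v.length := by
  by_contra hlt
  push Not at hlt
  have h1 : At c v (s - i) := hc.restrict hs (by omega) (by omega)
  rcases h.2.2 _ h1 with h4 | h4 <;> omega

theorem R.same_start {w v c c' : List α} {i : ℕ} (h : R v c) (h' : R v c') (hc : At w c i)
    (hc' : At w c' i) : c = c' := by
  have l1 := h.2.1.1
  have l2 := h'.2.1.1
  have e1 := h.next hc (hc'.trans h'.2.1.2.2) (by omega)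
  have e2 := h'.next hc' (hc.trans h.2.1.2.2) (by omega)
  exact hc.eq hc' (by omega)

theorem R.same_end {w v c c' : List α} {i i' : ℕ} (h : R v c) (h' : R v c') (hc : At w c i)
    (hc' : At w c' i') (he : i + c.length = i' + c'.length) : i = i' ∧ c = c' := by
  have hi : i = i' := by
    have l1 := h.2.1.1
    have l2 := h'.2.1.1
    rcases lt_trichotomy i i' with hlt | heq | hgt
    · have := h.next hc (hc'.trans h'.2.1.2.1) (by omega)
      omega
    · exact heq
    · have := h'.next hc' (hc.trans h.2.1.2.1) (by omega)
      omega
  subst hi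
  exact ⟨rfl, h.same_start h' hc hc'⟩

theorem keyword {w v a b : List α} {P Q : ℕ} (ha : R v a) (hb : R v b) (hP : At w a P)
    (hQ : At w b Q) (hPQ : P < Q) (hno : ∀ s, P < s → s ≤ Q → ¬ At w a s) :
    ∃ X : List α, At w X P ∧ X.length + P = Q + b.length ∧ At X a 0 ∧ At X b (Q - P) ∧
      LB v X ∧ ¬ ∃ v', R v' X := by
  have hbd := hQ.bound hb.ne
  have la := ha.2.1.1
  have lb := hb.2.1.1
  have lv : 0 < v.length := List.length_pos_iff.mpr ha.1
  have hX : At w (fac w P (Q + b.length - P)) P := fac_at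
  have hlen : (fac w P (Q + b.length - P)).length = Q + b.length - P := fac_length (by omega)
  generalize fac w P (Q + b.length - P) = X at hX hlen
  have hvQ : At w v Q := by simpa using hQ.trans hb.2.1.2.1
  have hvP : At w v P := by simpa using hP.trans ha.2.1.2.1
  have hvE : At w v (Q + (b.length - v.length)) := hQ.trans hb.2.1.2.2
  have hn := ha.next hP hvQ hPQ
  have hXa : At X a 0 := hX.restrict hP (by omega) (by omega)
  have hXb : At X b (Q - P) := hX.restrict hQ (by omega) (by omega)
  have hLB : LB v X := by
    refine ⟨ha.1, ⟨by omega, hX.restrict hvP (by omega) (by omega),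
      hX.restrict hvE (by omega) (by omega)⟩, ?_⟩
    intro c hc
    by_contra hlt
    push Not at hlt
    have lc := hc.1
    -- c begins with v, ends with v
    have hcv : At c v 0 := hc.2.1.restrict (hXa.trans ha.2.1.2.1) (by omega) (by omega)
    have hcv' : At c v (c.length - v.length) :=
      (hX.trans hc.2.2).restrict hvE (by omega) (by omega)
    have h1 := ha.next hP (hX.trans (hc.2.1.trans hcv')) (by omega)
    have hca : At c a 0 := hc.2.1.restrict hXa (by omega) (by omega)
    have hwa := hX.trans (hc.2.2.trans hca)
    refine hno _ ?_ ?_ hwa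
    · omega
    · by_contra hgt
      push Not at hgt
      have := hb.next hQ (hX.trans (hc.2.2.trans hcv)) (by omega)
      omega
  refine ⟨X, hX, by omega, hXa, hXb, hLB, ?_⟩
  rintro ⟨v', hv'⟩
  have := hv'.lb.unique hLB
  subst this
  rcases hv'.2.2 (Q - P) (hX.restrict hvQ (by omega) (by omega)) with h | h <;> omega

open Classical in
noncomputable def Oc (w v : List α) : Finset ℕ := (Finset.range w.length).filter (At w v)

theorem mem_Oc {w v : List α} (hv : v ≠ []) {i : ℕ} : i ∈ Oc w v ↔ At w v i := by
  simp only [Oc, Finset.mem_filter, Finset.mem_range]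
  refine ⟨fun h => h.2, fun h => ⟨?_, h⟩⟩
  have := h.bound hv
  have : 0 < v.length := List.length_pos_iff.mpr hv
  omega

def Pr (w : List α) : Finset (Σ _ : ℕ, ℕ) := (Finset.range w.length).sigma
  (fun i => Finset.range (w.length - i))

theorem sum_aux (n : ℕ) : 2 * ∑ i ∈ Finset.range n, (n - i) = n ^ 2 + n := by
  induction n with
  | zero => simp
  | succ n ih =>
    rw [Finset.sum_range_succ']
    simp only [Nat.add_sub_add_right, Nat.sub_zero]
    rw [mul_add, ih]; ring

theorem card_Pr (w : List α) : 2 * (Pr w).card = w.length ^ 2 + w.length := by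
  rw [Pr, Finset.card_sigma]
  simp only [Finset.card_range]
  exact sum_aux _

open Classical in
noncomputable def F (w : List α) : Finset (List α) := (Pr w).image (fun p => fac w p.1 (p.2 + 1))

theorem mem_F {w v : List α} : v ∈ F w ↔ v ≠ [] ∧ ∃ i, At w v i := by
  simp only [F, Finset.mem_image, Pr, Finset.mem_sigma, Finset.mem_range]
  constructor
  · rintro ⟨⟨i, k⟩, ⟨h1, h2⟩, rfl⟩
    simp only at h1 h2
    refine ⟨?_, i, fac_at⟩
    apply List.ne_nil_of_length_pos
    rw [fac_length (by simp only; omega)]; omega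
  · rintro ⟨hv, i, h⟩
    have hb := h.bound hv
    have hp : 0 < v.length := List.length_pos_iff.mpr hv
    refine ⟨⟨i, v.length - 1⟩, ⟨by simp only; omega, by simp only; omega⟩, ?_⟩
    refine At.eq (w := w) (i := i) fac_at h ?_
    rw [fac_length] <;> simp only <;> omega

theorem F_Oc_pos {w v : List α} (h : v ∈ F w) : (Oc w v).Nonempty := by
  obtain ⟨hv, i, hi⟩ := mem_F.mp h
  exact ⟨i, (mem_Oc hv).mpr hi⟩

open Classical in
noncomputable def Cl (w : List α) : Finset (List α) := (F w).filter (fun u => ∃ v, R v u)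

open Classical in
noncomputable def U (w : List α) : Finset (List α) :=
  (F w).filter (fun u => (¬ ∃ v, R v u) ∧ (Oc w u).card = 1)

open Classical in
noncomputable def lb (x : List α) : List α := if h : ∃ v, LB v x then h.choose else []

theorem LB.lb_eq {v x : List α} (h : LB v x) : lb x = v := by
  have h' : ∃ v, LB v x := ⟨v, h⟩
  rw [lb, dif_pos h']
  exact h'.choose_spec.unique h

open Classical in
theorem Cl_R {w u : List α} (h : u ∈ Cl w) : R (lb u) u := by
  obtain ⟨v, hv⟩ := (Finset.mem_filter.mp h).2
  rw [hv.lb.lb_eq]; exact hv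

open Classical in
theorem Cl_F {w u : List α} (h : u ∈ Cl w) : u ∈ F w := (Finset.mem_filter.mp h).1

open Classical in
/-- first occurrence -/
noncomputable def fst (w v : List α) : ℕ := if h : (Oc w v).Nonempty then (Oc w v).min' h else 0

open Classical in
/-- last occurrence -/
noncomputable def lst (w v : List α) : ℕ := if h : (Oc w v).Nonempty then (Oc w v).max' h else 0

theorem fst_at {w v : List α} (h : v ∈ F w) : At w v (fst w v) := by
  have h1 := F_Oc_pos h
  rw [fst, dif_pos h1]
  exact (mem_Oc (mem_F.mp h).1).mp (Finset.min'_mem _ _)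

theorem lst_at {w v : List α} (h : v ∈ F w) : At w v (lst w v) := by
  have h1 := F_Oc_pos h
  rw [lst, dif_pos h1]
  exact (mem_Oc (mem_F.mp h).1).mp (Finset.max'_mem _ _)

theorem fst_le {w v : List α} {i : ℕ} (h : v ∈ F w) (hi : At w v i) : fst w v ≤ i := by
  have h1 := F_Oc_pos h
  rw [fst, dif_pos h1]
  exact Finset.min'_le _ _ ((mem_Oc (mem_F.mp h).1).mpr hi)

theorem le_lst {w v : List α} {i : ℕ} (h : v ∈ F w) (hi : At w v i) : i ≤ lst w v := by
  have h1 := F_Oc_pos h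
  rw [lst, dif_pos h1]
  exact Finset.le_max' _ _ ((mem_Oc (mem_F.mp h).1).mpr hi)

theorem low_occ {w v : List α} {i : ℕ} (h : v ∈ F w) (h2 : (Oc w v).card ≤ 2) (hi : At w v i) :
    i = fst w v ∨ i = lst w v := by
  by_contra hne
  push Not at hne
  have hv := (mem_F.mp h).1
  have a := fst_le h hi
  have b := le_lst h hi
  have : ({fst w v, i, lst w v} : Finset ℕ) ⊆ Oc w v := by
    intro t ht
    simp only [Finset.mem_insert, Finset.mem_singleton] at ht
    rw [mem_Oc hv]
    rcases ht with rfl | rfl | rfl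
    · exact fst_at h
    · exact hi
    · exact lst_at h
  have := Finset.card_le_card this
  rw [Finset.card_eq_three.mpr ⟨_, _, _, by omega, by omega, by omega, rfl⟩] at this
  omega

theorem occ_one {w X : List α} {P : ℕ} (hX : X ≠ []) (h : At w X P)
    (h' : ∀ s, At w X s → s = P) : (Oc w X).card = 1 := by
  rw [Finset.card_eq_one]
  refine ⟨P, ?_⟩
  ext t
  rw [mem_Oc hX, Finset.mem_singleton]
  exact ⟨h' t, fun e => e ▸ h⟩

open Classical in
/-- The words paying for the low letters. -/
theorem pay {w v x y : List α} (hx : x ∈ F w) (hy : y ∈ F w) (rx : R v x) (ry : R v y)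
    (hxy : x ≠ y) (cx : (Oc w x).card ≤ 2) (hl : lst w y ≤ lst w x) :
    ∃ X ∈ U w, LB v X ∧
      ((fst w x < lst w y ∧ At w X (fst w x)) ∨
       (lst w y < fst w x ∧ At w X (lst w y) ∧ X.length + lst w y = fst w x + x.length)) := by
  have ne1 : fst w x ≠ lst w y := fun e => hxy (rx.same_start ry (e ▸ fst_at hx) (lst_at hy))
  have ne2 : lst w y ≠ lst w x := fun e => hxy (rx.same_start ry (lst_at hx) (e ▸ lst_at hy))
  rcases lt_or_gt_of_ne ne1 with hlt | hgt
  · obtain ⟨X, h1, h2, h3, h4, h5, h6⟩ := keyword rx ry (fst_at hx) (lst_at hy) hlt (by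
      intro s hs1 hs2 hs
      rcases low_occ hx cx hs with h | h <;> omega)
    have hX : X ≠ [] := by
      rintro rfl; have := h5.2.1.1; simp at this
    refine ⟨X, ?_, h5, Or.inl ⟨hlt, h1⟩⟩
    rw [U, Finset.mem_filter]
    refine ⟨mem_F.mpr ⟨hX, _, h1⟩, h6, occ_one hX h1 ?_⟩
    intro s hs
    have a1 := fst_le hx (hs.trans h3)
    have a2 := le_lst hy (hs.trans h4)
    omega
  · obtain ⟨X, h1, h2, h3, h4, h5, h6⟩ := keyword ry rx (lst_at hy) (fst_at hx) hgt (by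
      intro s hs1 hs2 hs
      have := le_lst hy hs
      omega)
    have hX : X ≠ [] := by
      rintro rfl; have := h5.2.1.1; simp at this
    refine ⟨X, ?_, h5, Or.inr ⟨hgt, h1, h2⟩⟩
    rw [U, Finset.mem_filter]
    refine ⟨mem_F.mpr ⟨hX, _, h1⟩, h6, occ_one hX h1 ?_⟩
    intro s hs
    have a1 := le_lst hy (hs.trans h3)
    have a2 := fst_le hx (hs.trans h4)
    omega

open Classical in
theorem U_unique {w X : List α} {i j : ℕ} (h : X ∈ U w) (hi : At w X i) (hj : At w X j) :
    i = j := by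
  rw [U, Finset.mem_filter] at h
  have hX := (mem_F.mp h.1).1
  exact Finset.card_le_one.mp h.2.2.le i ((mem_Oc hX).mpr hi) j ((mem_Oc hX).mpr hj)

open Classical in
theorem low_bound (w v : List α) (L : Finset (List α))
    (hL : ∀ c ∈ L, c ∈ F w ∧ R v c ∧ (Oc w c).card ≤ 2) :
    L.card ≤ ((U w).filter (fun X => lb X = v)).card + 1 := by
  rcases L.eq_empty_or_nonempty with rfl | hne
  · simp
  obtain ⟨y, hyL, hmin⟩ := Finset.exists_min_image L (lst w) hne
  rw [← Finset.card_erase_add_one hyL]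
  apply Nat.add_le_add_right
  obtain ⟨hy, ry, _⟩ := hL y hyL
  have hp : ∀ x ∈ L.erase y, ∃ X ∈ U w, LB v X ∧
      ((fst w x < lst w y ∧ At w X (fst w x)) ∨
       (lst w y < fst w x ∧ At w X (lst w y) ∧ X.length + lst w y = fst w x + x.length)) := by
    intro x hx
    obtain ⟨hxy, hxL⟩ := Finset.mem_erase.mp hx
    obtain ⟨hxF, rx, cx⟩ := hL x hxL
    exact pay hxF hy rx ry hxy cx (hmin x hxL)
  choose! φ h1 h2 h3 using hp
  apply Finset.card_le_card_of_injOn φ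
  · intro x hx
    exact Finset.mem_filter.mpr ⟨h1 x hx, (h2 x hx).lb_eq⟩
  · intro x hx x' hx' he
    have hx := Finset.mem_coe.mp hx
    have hx' := Finset.mem_coe.mp hx'
    obtain ⟨hxF, rx, _⟩ := hL x (Finset.mem_of_mem_erase hx)
    obtain ⟨hxF', rx', _⟩ := hL x' (Finset.mem_of_mem_erase hx')
    have hu := h1 x hx
    have g := h3 x hx
    have g' := h3 x' hx'
    rw [← he] at g'
    rcases g with ⟨a1, a2⟩ | ⟨a1, a2, a3⟩ <;> rcases g' with ⟨b1, b2⟩ | ⟨b1, b2, b3⟩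
    · have := U_unique hu a2 b2
      exact rx.same_start rx' (fst_at hxF) (this ▸ fst_at hxF')
    · have := U_unique hu a2 b2
      omega
    · have := U_unique hu a2 b2
      omega
    · exact (rx.same_end rx' (fst_at hxF) (fst_at hxF') (by omega)).2

open Classical in
/-- The local inequality. -/
theorem star (w v : List α) :
    ((Cl w).filter (fun c => lb c = v)).card ≤
      ((U w).filter (fun X => lb X = v)).card +
      ∑ c ∈ (Cl w).filter (fun c => lb c = v), ((Oc w c).card - 2) + 1 := by
  set G := (Cl w).filter (fun c => lb c = v) with hG
  have h1 := low_bound w v (G.filter (fun c => (Oc w c).card ≤ 2)) (by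
    intro c hc
    obtain ⟨hc1, hc2⟩ := Finset.mem_filter.mp hc
    obtain ⟨hc3, hc4⟩ := Finset.mem_filter.mp hc1
    exact ⟨Cl_F hc3, hc4 ▸ Cl_R hc3, hc2⟩)
  have h2 : (G.filter (fun c => ¬ (Oc w c).card ≤ 2)).card ≤ ∑ c ∈ G, ((Oc w c).card - 2) := by
    rw [Finset.card_filter]
    apply Finset.sum_le_sum
    intro c _
    split_ifs <;> omega
  have h3 := Finset.card_filter_add_card_filter_not (s := G) (fun c => (Oc w c).card ≤ 2)
  omega

theorem two_occ {w u : List α} (h : u ∈ Cl w) : lb u ∈ F w ∧ 2 ≤ (Oc w (lb u)).card := by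
  have r := Cl_R h
  obtain ⟨_, i, hi⟩ := mem_F.mp (Cl_F h)
  have l := r.2.1.1
  have a1 := hi.trans r.2.1.2.1
  have a2 := hi.trans r.2.1.2.2
  refine ⟨mem_F.mpr ⟨r.1, _, a1⟩, ?_⟩
  have : 1 < (Oc w (lb u)).card :=
    Finset.one_lt_card.mpr ⟨_, (mem_Oc r.1).mpr a1, _, (mem_Oc r.1).mpr a2, by omega⟩
  omega

open Classical in
theorem global (w : List α) :
    (Cl w).card ≤ ((F w).filter (fun v => 2 ≤ (Oc w v).card)).card + (U w).card +
      ∑ c ∈ Cl w, ((Oc w c).card - 2) := by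
  set D := (F w).filter (fun v => 2 ≤ (Oc w v).card) with hD
  have hmaps : ∀ c ∈ Cl w, lb c ∈ D := fun c hc =>
    Finset.mem_filter.mpr (two_occ hc)
  rw [Finset.card_eq_sum_card_fiberwise (f := lb) (t := D) hmaps,
    ← Finset.sum_fiberwise_of_maps_to (g := lb) (t := D) hmaps]
  have hU : ∑ v ∈ D, ((U w).filter (fun X => lb X = v)).card ≤ (U w).card := by
    rw [← Finset.card_biUnion]
    · apply Finset.card_le_card
      intro x hx
      simp only [Finset.mem_biUnion, Finset.mem_filter] at hx
      obtain ⟨_, _, h, _⟩ := hx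
      exact h
    · intro a _ b _ hab
      rw [Function.onFun, Finset.disjoint_left]
      intro x hx hx'
      exact hab ((Finset.mem_filter.mp hx).2.symm.trans (Finset.mem_filter.mp hx').2)
  have hs := Finset.sum_le_sum (s := D) (fun v _ => star w v)
  rw [Finset.sum_add_distrib, Finset.sum_add_distrib, Finset.sum_const, smul_eq_mul, mul_one] at hs
  omega

open Classical in
theorem count_pairs (w : List α) :
    (F w).card + ∑ u ∈ Cl w, (Oc w u).card ≤ (Pr w).card := by
  set A : Finset (Σ _ : ℕ, ℕ) := (F w).image (fun v => ⟨fst w v, v.length - 1⟩) with hA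
  set B : Finset (Σ _ : ℕ, ℕ) := ((Cl w).sigma (fun u => Oc w u)).image
    (fun q => ⟨q.2 + (q.1.length - (lb q.1).length), (lb q.1).length - 1⟩) with hB
  have cA : A.card = (F w).card := by
    apply Finset.card_image_of_injOn
    intro v hv v' hv' he
    have hv := Finset.mem_coe.mp hv
    have hv' := Finset.mem_coe.mp hv'
    simp only [Sigma.mk.injEq, heq_eq_eq] at he
    have p1 := List.length_pos_iff.mpr (mem_F.mp hv).1
    have p2 := List.length_pos_iff.mpr (mem_F.mp hv').1
    exact (fst_at hv).eq (he.1 ▸ fst_at hv') (by omega)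
  have cB : B.card = ∑ u ∈ Cl w, (Oc w u).card := by
    rw [← Finset.card_sigma]
    apply Finset.card_image_of_injOn
    rintro ⟨u, i⟩ hq ⟨u', i'⟩ hq' he
    obtain ⟨hu, hi⟩ := Finset.mem_sigma.mp (Finset.mem_coe.mp hq)
    obtain ⟨hu', hi'⟩ := Finset.mem_sigma.mp (Finset.mem_coe.mp hq')
    simp only at hu hi hu' hi'
    simp only [Sigma.mk.injEq, heq_eq_eq] at he
    have r := Cl_R hu
    have r' := Cl_R hu'
    rw [mem_Oc r.ne] at hi
    rw [mem_Oc r'.ne] at hi'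
    have p1 := List.length_pos_iff.mpr r.1
    have p2 := List.length_pos_iff.mpr r'.1
    have l1 := r.2.1.1
    have l2 := r'.2.1.1
    have hv : lb u = lb u' := by
      have a := hi.trans r.2.1.2.2
      have a' := hi'.trans r'.2.1.2.2
      rw [← he.1] at a'
      exact a.eq a' (by omega)
    have r'' : R (lb u) u' := hv ▸ r'
    obtain ⟨e1, e2⟩ := r.same_end r'' hi hi' (by omega)
    subst e1; subst e2; rfl
  have dis : Disjoint A B := by
    rw [Finset.disjoint_left]
    intro p hpA hpB
    obtain ⟨v, hv, rfl⟩ := Finset.mem_image.mp hpA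
    obtain ⟨⟨u, i⟩, hq, he⟩ := Finset.mem_image.mp hpB
    obtain ⟨hu, hi⟩ := Finset.mem_sigma.mp hq
    simp only at hu hi
    simp only [Sigma.mk.injEq, heq_eq_eq] at he
    have r := Cl_R hu
    rw [mem_Oc r.ne] at hi
    have p1 := List.length_pos_iff.mpr r.1
    have p2 := List.length_pos_iff.mpr (mem_F.mp hv).1
    have l1 := r.2.1.1
    have a := hi.trans r.2.1.2.2
    rw [he.1] at a
    have e : lb u = v := a.eq (fst_at hv) (by omega)
    have := fst_le hv (e ▸ hi.trans r.2.1.2.1)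
    rw [e] at l1 he
    omega
  rw [← cA, ← cB, ← Finset.card_union_of_disjoint dis]
  apply Finset.card_le_card
  intro p hp
  rw [Pr, Finset.mem_sigma, Finset.mem_range, Finset.mem_range]
  rcases Finset.mem_union.mp hp with h | h
  · obtain ⟨v, hv, rfl⟩ := Finset.mem_image.mp h
    have := (fst_at hv).bound (mem_F.mp hv).1
    have p2 := List.length_pos_iff.mpr (mem_F.mp hv).1
    simp only
    omega
  · obtain ⟨⟨u, i⟩, hq, rfl⟩ := Finset.mem_image.mp h
    obtain ⟨hu, hi⟩ := Finset.mem_sigma.mp hq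
    simp only at hu hi
    have r := Cl_R hu
    rw [mem_Oc r.ne] at hi
    have := hi.bound r.ne
    have p1 := List.length_pos_iff.mpr r.1
    have l1 := r.2.1.1
    simp only
    omega

open Classical in
theorem main_bound (w : List α) : 3 * (Cl w).card ≤ (Pr w).card := by
  have h1 := global w
  have h2 := count_pairs w
  set K := (Cl w).filter (fun c => (Oc w c).card = 1) with hK
  have h3 : ∑ c ∈ Cl w, ((Oc w c).card - 2) + 2 * (Cl w).card =
      ∑ c ∈ Cl w, (Oc w c).card + K.card := by
    rw [hK, Finset.card_filter, mul_comm, ← smul_eq_mul, ← Finset.sum_const,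
      ← Finset.sum_add_distrib, ← Finset.sum_add_distrib]
    apply Finset.sum_congr rfl
    intro c hc
    have := Finset.card_pos.mpr (F_Oc_pos (Cl_F hc))
    split_ifs <;> omega
  have h4 : ((F w).filter (fun v => 2 ≤ (Oc w v).card)).card + (U w).card + K.card
      ≤ (F w).card := by
    rw [hK, U, Cl, Finset.filter_filter, Finset.card_filter, Finset.card_filter,
      Finset.card_filter, ← Finset.sum_add_distrib, ← Finset.sum_add_distrib, Finset.card_eq_sum_ones]
    apply Finset.sum_le_sum
    intro c _
    by_cases hc : ∃ v, R v c
    · simp only [hc, not_true_eq_false, false_and, true_and, if_false]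
      split_ifs <;> omega
    · simp only [hc, not_false_eq_true, false_and, true_and, if_false]
      split_ifs <;> omega
  omega

theorem at_iff {w v : List α} {i : ℕ} (hb : i + v.length ≤ w.length) :
    At w v i ↔ (w.drop i).take v.length = v := by
  constructor
  · intro h
    exact At.eq (w := w) (i := i) fac_at h (fac_length hb)
  · intro h
    have : At w (fac w i v.length) i := fac_at
    rw [fac, h] at this
    exact this

theorem closed_R [DecidableEq α] {u : List α} (h : ClosedWord u) (h2 : 2 ≤ u.length) :
    ∃ v, R v u := by
  rcases h with h | ⟨k, hk, hsuf, hocc⟩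
  · omega
  rw [Finset.mem_Ioo] at hk
  refine ⟨u.take k, ?_⟩
  have hl : (u.take k).length = k := by simp; omega
  have h0 : At u (u.take k) 0 := (at_iff (by omega)).mpr (by rw [hl]; rfl)
  have h1 : At u (u.take k) (u.length - k) := by
    obtain ⟨s, hs⟩ := hsuf
    have hsl : s.length = u.length - k := by
      have := congrArg List.length hs
      rw [List.length_append, hl] at this
      omega
    rw [at_iff (by omega), hl]
    have e : u.drop (u.length - k) = u.take k := by
      have h3 : (s ++ u.take k).drop s.length = u.take k := List.drop_left
      rw [hs, hsl] at h3
      exact h3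
    rw [e, List.take_take, min_self]
  have hv : u.take k ≠ [] := List.ne_nil_of_length_pos (by omega)
  refine ⟨hv, ⟨by omega, h0, by rw [hl]; exact h1⟩, ?_⟩
  intro s hs
  rw [hl]
  by_contra hne
  push Not at hne
  rw [occCount] at hocc
  have hsub : ({0, s, u.length - k} : Finset ℕ) ⊆ (Finset.range (u.length + 1)).filter
      (fun i => i + (u.take k).length ≤ u.length ∧
        (u.drop i).take (u.take k).length = u.take k) := by
    intro t ht
    have hat : At u (u.take k) t := by
      simp only [Finset.mem_insert, Finset.mem_singleton] at ht
      rcases ht with rfl | rfl | rfl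
      · exact h0
      · exact hs
      · exact h1
    have hb := hat.bound hv
    rw [Finset.mem_filter, Finset.mem_range]
    exact ⟨by omega, hb, (at_iff hb).mp hat⟩
  have hc := Finset.card_le_card hsub
  rw [hocc, Finset.card_eq_three.mpr ⟨_, _, _, by omega, by omega, by omega, rfl⟩] at hc
  omega

theorem mem_closed [DecidableEq α] {u w : List α} (h : u ∈ closedFactors w) :
    u <:+: w ∧ ClosedWord u := by
  rw [closedFactors, Finset.mem_filter] at h
  simp only [List.mem_toFinset, List.mem_flatMap, List.mem_inits, List.mem_tails] at h
  obtain ⟨⟨a, h1, h2⟩, h3⟩ := h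
  exact ⟨h2.isInfix.trans h1.isInfix, h3⟩

theorem infix_at {u w : List α} (h : u <:+: w) : ∃ i, At w u i := by
  obtain ⟨s, t, rfl⟩ := h
  refine ⟨s.length, ?_⟩
  intro k hk
  rw [List.append_assoc, List.getElem?_append_right (by omega), List.getElem?_append_left (by omega)]
  simp

theorem cl'_le [DecidableEq α] (w : List α) : clCount' w ≤ (Cl w).card := by
  classical
  rw [clCount']
  apply Finset.card_le_card
  intro u hu
  obtain ⟨h1, h2⟩ := Finset.mem_filter.mp hu
  obtain ⟨h3, h4⟩ := mem_closed h1
  rw [Cl, Finset.mem_filter]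
  exact ⟨mem_F.mpr ⟨List.ne_nil_of_length_pos (by omega), infix_at h3⟩, closed_R h4 h2⟩

theorem cl_le [DecidableEq α] (w : List α) : clCount w ≤ clCount' w + (w.length + 1) := by
  rw [clCount, clCount', ← Finset.card_filter_add_card_filter_not (s := closedFactors w)
    (fun u => 2 ≤ u.length)]
  apply Nat.add_le_add_left
  have hsub : (closedFactors w).filter (fun u => ¬ 2 ≤ u.length) ⊆
      insert [] ((Finset.range w.length).image (fun i => fac w i 1)) := by
    intro u hu
    obtain ⟨h1, h2⟩ := Finset.mem_filter.mp hu
    rw [Finset.mem_insert]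
    by_cases hu : u = []
    · exact Or.inl hu
    right
    obtain ⟨i, hi⟩ := infix_at (mem_closed h1).1
    have hb := hi.bound hu
    have hp := List.length_pos_iff.mpr hu
    refine Finset.mem_image.mpr ⟨i, Finset.mem_range.mpr (by omega), ?_⟩
    exact At.eq (w := w) (i := i) fac_at hi (by rw [fac_length (by omega)]; omega)
  refine (Finset.card_le_card hsub).trans ((Finset.card_insert_le _ _).trans ?_)
  have := Finset.card_image_le (s := Finset.range w.length) (f := fun i => fac w i 1)
  rw [Finset.card_range] at this
  omega

end CF

/-- for every word of length n, the number of distinct closed factors of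
length ≥ 2 is at most n²/6 + n/6, and the total number of distinct closed factors is
at most n²/6 + 7n/6 + 1. -/
theorem stmt17 [DecidableEq α] (w : List α) :
    6 * clCount' w ≤ w.length ^ 2 + w.length ∧
    6 * clCount w ≤ w.length ^ 2 + 7 * w.length + 6 := by
  have h1 := CF.main_bound w
  have h2 := CF.card_Pr w
  have h3 := CF.cl'_le w
  have h4 := CF.cl_le w
  constructor <;> omega
end

section
/- Let w be a finite word of length n, and suppose cl'(w) − cl'(w⁻) > n/3 and cl'(w) − cl'(⁻w) > n/3, where w⁻ and ⁻w are the prefix and the suffix of w of length n−1. Then cl'(w) ≤ n²/6 + n/6. -/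
open List

variable {α : Type*}

section Positions

variable {β : Type*}

/-- The factors of length `k` at positions `i` and `j` agree. -/
def Eqv (f : ℕ → β) (i j k : ℕ) : Prop := ∀ t < k, f (i + t) = f (j + t)

/-- `k` is the length of a border that makes the factor of length `l` at `i` closed. -/
def BorderAt (f : ℕ → β) (i l k : ℕ) : Prop :=
  1 ≤ k ∧ k < l ∧ Eqv f i (i + (l - k)) k ∧ ∀ d, 0 < d → d < l - k → ¬ Eqv f i (i + d) k

def ClosedAt (f : ℕ → β) (n i l : ℕ) : Prop := i + l ≤ n ∧ ∃ k, BorderAt f i l k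

def Rpt (f : ℕ → β) (n i k : ℕ) : Prop := ∃ d, 0 < d ∧ i + d + k ≤ n ∧ Eqv f i (i + d) k

open Classical in
/-- Lengths of closed factors at `i` with no occurrence strictly between `i` and `x`. -/
noncomputable def NewW (f : ℕ → β) (n i x : ℕ) : Finset ℕ :=
  (Finset.range (n + 1)).filter
    (fun l => ClosedAt f n i l ∧ ¬ ∃ j, i < j ∧ j < x ∧ j + l ≤ n ∧ Eqv f i j l)

lemma mem_NewW {f : ℕ → β} {n i x l : ℕ} : l ∈ NewW f n i x ↔
    ClosedAt f n i l ∧ ¬ ∃ j, i < j ∧ j < x ∧ j + l ≤ n ∧ Eqv f i j l := by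
  classical
  simp only [NewW, Finset.mem_filter, Finset.mem_range]
  constructor
  · exact fun h => h.2
  · intro h
    refine ⟨?_, h⟩
    have := h.1.1
    omega

lemma Eqv.symm' {f : ℕ → β} {i j k : ℕ} (h : Eqv f i j k) : Eqv f j i k :=
  fun t ht => (h t ht).symm

lemma Eqv.trans' {f : ℕ → β} {i j m k : ℕ} (h : Eqv f i j k) (h' : Eqv f j m k) : Eqv f i m k :=
  fun t ht => (h t ht).trans (h' t ht)

lemma Eqv.mono' {f : ℕ → β} {i j k k' : ℕ} (h : Eqv f i j k) (hk : k' ≤ k) : Eqv f i j k' :=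
  fun t ht => h t (by omega)

lemma Eqv.at' {f : ℕ → β} {i j k : ℕ} (h : Eqv f i j k) (a b : ℕ) (h1 : i ≤ a) (h2 : a < i + k)
    (h3 : b + i = a + j) : f a = f b := by
  have := h (a - i) (by omega)
  rw [show i + (a - i) = a by omega, show j + (a - i) = b by omega] at this
  exact this

/-- shift to a sub-interval -/
lemma Eqv.sub' {f : ℕ → β} {i j k : ℕ} (h : Eqv f i j k) (a b m : ℕ) (h1 : i ≤ a)
    (h2 : a + m ≤ i + k) (h3 : b + i = a + j) : Eqv f a b m :=
  fun t ht => h.at' (a + t) (b + t) (by omega) (by omega) (by omega)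

lemma ClosedAt.shift {f : ℕ → β} {n i j l : ℕ} (h : ClosedAt f n i l) (hj : j + l ≤ n)
    (he : Eqv f i j l) : ClosedAt f n j l := by
  obtain ⟨hi, k, h1, h2, h3, h4⟩ := h
  refine ⟨hj, k, h1, h2, ?_, ?_⟩
  · exact ((he.sub' i j k (by omega) (by omega) (by omega)).symm'.trans' h3).trans'
      (he.sub' (i + (l - k)) (j + (l - k)) k (by omega) (by omega) (by omega))
  · intro d hd hd' hE
    apply h4 d hd hd'
    exact ((he.sub' i j k (by omega) (by omega) (by omega)).trans' hE).trans'
      (he.sub' (i + d) (j + d) k (by omega) (by omega) (by omega)).symm'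

lemma BorderAt.len_unique {f : ℕ → β} {i l l' k : ℕ} (h : BorderAt f i l k)
    (h' : BorderAt f i l' k) : l = l' := by
  obtain ⟨h1, h2, h3, h4⟩ := h
  obtain ⟨h1', h2', h3', h4'⟩ := h'
  by_contra hne
  rcases Nat.lt_or_gt_of_ne hne with hlt | hlt
  · exact h4' (l - k) (by omega) (by omega) h3
  · exact h4 (l' - k) (by omega) (by omega) h3'

lemma BorderAt.le_of_eqv {f : ℕ → β} {i l k d : ℕ} (h : BorderAt f i l k) (hd : 0 < d)
    (he : Eqv f i (i + d) k) : l ≤ k + d := by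
  by_contra hlt
  exact h.2.2.2 d hd (by omega) he

lemma card_le_of_border {f : ℕ → β} {i lo hi : ℕ} (S : Finset ℕ)
    (h : ∀ l ∈ S, ∃ k, BorderAt f i l k ∧ lo < k ∧ k ≤ hi) : S.card ≤ hi - lo := by
  classical
  choose! K hK using h
  have : S.card ≤ (Finset.Ioc lo hi).card := by
    apply Finset.card_le_card_of_injOn K
    · intro l hl
      have := hK l hl
      simp only [Finset.coe_Ioc, Set.mem_Ioc]
      exact this.2
    · intro l hl l' hl' he
      have a := (hK l hl).1
      have b := (hK l' hl').1
      rw [← he] at b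
      exact a.len_unique b
  simpa using this

lemma ClosedAt.rep {f : ℕ → β} {n i l k : ℕ} (h : i + l ≤ n) (hb : BorderAt f i l k) :
    Rpt f n i k :=
  ⟨l - k, by have := hb.2.1; omega, by have := hb.2.1; omega, hb.2.2.1⟩

lemma card_NewW_le_of_rep {f : ℕ → β} {n i x m : ℕ} (h : ∀ k, Rpt f n i k → k ≤ m) :
    (NewW f n i x).card ≤ m := by
  have := card_le_of_border (f := f) (i := i) (lo := 0) (hi := m) (NewW f n i x) ?_
  · simpa using this
  · intro l hl
    obtain ⟨⟨hi, k, hk⟩, -⟩ := mem_NewW.1 hl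
    exact ⟨k, hk, hk.1, h k (ClosedAt.rep hi hk)⟩

lemma card_NewW_le_of_short {f : ℕ → β} {n i x L D k1 d1 : ℕ} (h : ∀ k, Rpt f n i k → k ≤ L)
    (hD : 0 < D) (hx : i + D < x) (hn : i + D + L ≤ n) (he : Eqv f i (i + D) L)
    (hd1 : 0 < d1) (hk1 : k1 + d1 ≤ L) (he1 : Eqv f i (i + d1) k1) :
    (NewW f n i x).card ≤ L - k1 := by
  apply card_le_of_border (f := f) (i := i)
  intro l hl
  obtain ⟨⟨hi, k, hk⟩, hno⟩ := mem_NewW.1 hl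
  refine ⟨k, hk, ?_, h k (ClosedAt.rep hi hk)⟩
  by_contra hlt
  have := hk.le_of_eqv hd1 (he1.mono' (by omega))
  exact hno ⟨i + D, by omega, hx, by omega, he.mono' (by omega)⟩

lemma card_NewW_le_shift {f : ℕ → β} {n i x L D : ℕ} (h : ∀ k, Rpt f n i k → k ≤ L)
    (hD : 0 < D) (hx : i + D < x) (hn : i + D + L ≤ n) (he : Eqv f i (i + D) L) :
    (NewW f n i x).card ≤ D := by
  have : (NewW f n i x) ⊆ Finset.Ioc L (L + D) := by
    intro l hl
    obtain ⟨⟨hi, k, hk⟩, hno⟩ := mem_NewW.1 hl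
    have hkL := h k (ClosedAt.rep hi hk)
    have := hk.le_of_eqv hD (he.mono' hkL)
    rw [Finset.mem_Ioc]
    refine ⟨?_, by omega⟩
    by_contra hlt
    exact hno ⟨i + D, by omega, hx, by omega, he.mono' (by omega)⟩
  simpa using Finset.card_le_card this

lemma exists_max_rep {f : ℕ → β} {n i : ℕ} (h : ∃ k, 1 ≤ k ∧ Rpt f n i k) :
    ∃ L D, 1 ≤ L ∧ 0 < D ∧ i + D + L ≤ n ∧ Eqv f i (i + D) L ∧ ∀ k, Rpt f n i k → k ≤ L := by
  classical
  obtain ⟨k, hk, hr⟩ := h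
  have hb : ∀ k, Rpt f n i k → k ≤ n := by
    rintro k ⟨d, hd, h, -⟩
    omega
  have hs := Nat.findGreatest_spec (P := Rpt f n i) (hb k hr) hr
  obtain ⟨D, hD, hn, he⟩ := hs
  refine ⟨Nat.findGreatest (Rpt f n i) n, D, ?_, hD, hn, he, ?_⟩
  · exact le_trans hk (Nat.le_findGreatest (hb k hr) hr)
  · intro k hk
    exact Nat.le_findGreatest (hb k hk) hk

structure Pref (f : ℕ → β) (n L r c k0 r0 : ℕ) : Prop where
  hL : L + 1 = k0 + c
  hk0 : 1 ≤ k0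
  hc : n < 3 * c
  hrn : r + L ≤ n
  hr0r : r0 ≤ r
  hcr0 : c ≤ r0
  per : Eqv f 0 r L
  hmx : ∀ d, 0 < d → d + (L + 1) ≤ n → ¬ Eqv f 0 d (L + 1)
  k1 : ∃ d, 0 < d ∧ (k0 - 1) + d ≤ L ∧ Eqv f 0 d (k0 - 1)
  r0eq : Eqv f 0 r0 k0
  r0min : ∀ d, 0 < d → d < r0 → ¬ Eqv f 0 d k0

structure Suff (f : ℕ → β) (n L r c k0 r0 : ℕ) : Prop where
  hL : L + 1 = k0 + c
  hk0 : 1 ≤ k0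
  hc : n < 3 * c
  hrn : r + L ≤ n
  hr0r : r0 ≤ r
  hcr0 : c ≤ r0
  per : Eqv f (n - L - r) (n - L) L
  hmx : ∀ d, 0 < d → d + (L + 1) ≤ n → ¬ Eqv f (n - (L + 1) - d) (n - (L + 1)) (L + 1)
  r0eq : Eqv f (n - k0 - r0) (n - k0) k0
  r0min : ∀ d, 0 < d → d < r0 → ¬ Eqv f (n - k0 - d) (n - k0) k0

lemma exists_pref {f : ℕ → β} {n : ℕ} (h : n < 3 * (NewW f n 0 n).card) :
    ∃ L r c k0 r0, Pref f n L r c k0 r0 := by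
  classical
  have hrep : ∃ k, 1 ≤ k ∧ Rpt f n 0 k := by
    have : (NewW f n 0 n).Nonempty := by
      rw [← Finset.card_pos]; omega
    obtain ⟨l, hl⟩ := this
    obtain ⟨⟨hi, k, hk⟩, -⟩ := mem_NewW.1 hl
    exact ⟨k, hk.1, ClosedAt.rep hi hk⟩
  obtain ⟨L, r, hL1, hr, hn, he, hmax⟩ := exists_max_rep hrep
  simp only [Nat.zero_add] at hn he
  have hex : ∃ k, ¬ ∃ d, 0 < d ∧ k + d ≤ L ∧ Eqv f 0 d k :=
    ⟨L, by rintro ⟨d, h1, h2, -⟩; omega⟩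
  obtain ⟨k0, hk0s, hk0m⟩ : ∃ k0, (¬ ∃ d, 0 < d ∧ k0 + d ≤ L ∧ Eqv f 0 d k0) ∧
      ∀ k < k0, ∃ d, 0 < d ∧ k + d ≤ L ∧ Eqv f 0 d k :=
    ⟨Nat.find hex, Nat.find_spec hex, fun k hk => not_not.1 (Nat.find_min hex hk)⟩
  have hk01 : 1 ≤ k0 := by
    by_contra h0
    have h0 : k0 = 0 := by omega
    subst h0
    exact hk0s ⟨1, by omega, by omega, fun t ht => by omega⟩
  have hk0L : k0 ≤ L := by
    by_contra h0
    obtain ⟨d, hd, h1, -⟩ := hk0m L (by omega)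
    omega
  obtain ⟨d1, hd1, hd1L, hd1e⟩ := hk0m (k0 - 1) (by omega)
  have hcard : (NewW f n 0 n).card ≤ L - (k0 - 1) :=
    card_NewW_le_of_short (D := r) (d1 := d1) hmax hr (by omega) (by omega) (by simpa using he) hd1 hd1L (by simpa using hd1e)
  have hex2 : ∃ d, 0 < d ∧ Eqv f 0 d k0 := ⟨r, hr, he.mono' hk0L⟩
  obtain ⟨r0, hr0, hr0min⟩ : ∃ r0, (0 < r0 ∧ Eqv f 0 r0 k0) ∧
      ∀ d < r0, ¬ (0 < d ∧ Eqv f 0 d k0) :=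
    ⟨Nat.find hex2, Nat.find_spec hex2, fun d hd => Nat.find_min hex2 hd⟩
  refine ⟨L, r, L - (k0 - 1), k0, r0, ?_⟩
  refine ⟨by omega, hk01, by omega, hn, ?_, ?_, he, ?_, ⟨d1, hd1, hd1L, hd1e⟩, hr0.2, ?_⟩
  · by_contra hlt
    exact hr0min r (by omega) ⟨hr, he.mono' hk0L⟩
  · by_contra hlt
    exact hk0s ⟨r0, hr0.1, by omega, hr0.2⟩
  · intro d hd hdn hE
    have := hmax (L + 1) ⟨d, hd, by omega, by simpa using hE⟩
    omega
  · intro d hd hlt hE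
    exact hr0min d hlt ⟨hd, hE⟩

lemma eqv_reverse {f g : ℕ → β} {n i j k : ℕ} (hfg : ∀ t < n, g t = f (n - 1 - t))
    (hi : i + k ≤ n) (hj : j + k ≤ n) : Eqv g i j k ↔ Eqv f (n - k - i) (n - k - j) k := by
  constructor
  · intro h t ht
    have := h (k - 1 - t) (by omega)
    rw [hfg _ (by omega), hfg _ (by omega)] at this
    rw [show n - 1 - (i + (k - 1 - t)) = n - k - i + t by omega,
      show n - 1 - (j + (k - 1 - t)) = n - k - j + t by omega] at this
    exact this
  · intro h t ht
    have := h (k - 1 - t) (by omega)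
    rw [hfg _ (by omega), hfg _ (by omega)]
    rw [show n - 1 - (i + t) = n - k - i + (k - 1 - t) by omega,
      show n - 1 - (j + t) = n - k - j + (k - 1 - t) by omega]
    exact this

lemma Pref.reverse {f g : ℕ → β} {n L r c k0 r0 : ℕ} (hfg : ∀ t < n, g t = f (n - 1 - t))
    (h : Pref g n L r c k0 r0) : Suff f n L r c k0 r0 := by
  obtain ⟨h1, h2, h3, h4, h5, h6, h7, h8, h9, h10, h11⟩ := h
  refine ⟨h1, h2, h3, h4, h5, h6, ?_, ?_, ?_, ?_⟩
  · exact ((eqv_reverse hfg (by omega) (by omega)).1 h7).symm'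
  · intro d hd hdn hE
    exact h8 d hd hdn ((eqv_reverse hfg (by omega) (by omega)).2 hE.symm')
  · exact ((eqv_reverse hfg (by omega) (by omega)).1 h10).symm'
  · intro d hd hdn hE
    exact h11 d hd hdn ((eqv_reverse hfg (by omega) (by omega)).2 hE.symm')
section LeftPeel

variable {f : ℕ → β} {n L r c k0 r0 : ℕ}

lemma Suff.period (h : Suff f n L r c k0 r0) {t : ℕ} (h1 : n - L - r ≤ t) (h2 : t + r < n) :
    f t = f (t + r) := by
  have := h.hrn
  exact h.per.at' t (t + r) h1 (by omega) (by omega)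

lemma Suff.periodE (h : Suff f n L r c k0 r0) {j m : ℕ} (h1 : n - L - r ≤ j) (h2 : j + r + m ≤ n) :
    Eqv f j (j + r) m := by
  intro t ht
  rw [h.period (t := j + t) (by omega) (by omega)]
  congr 1
  omega

lemma Suff.b2 (h : Suff f n L r c k0 r0) {j k D : ℕ} (h1 : j + k0 + r ≤ n) (h2 : n ≤ j + k + r)
    (hD : 0 < D) (hn : j + D + k ≤ n) (he : Eqv f j (j + D) k) : D = r ∨ D + r0 ≤ r := by
  by_contra hcon
  have a1 := h.hL
  have a2 := h.hk0
  have a3 := h.hc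
  have a4 := h.hrn
  have a5 := h.hr0r
  have a6 := h.hcr0
  apply h.r0min (r - D) (by omega) (by omega)
  have e1 := h.periodE (j := n - r - k0) (m := k0) (by omega) (by omega)
  rw [show n - r - k0 + r = n - k0 by omega] at e1
  have e2 := he.sub' (n - r - k0) (n - k0 - (r - D)) k0 (by omega) (by omega) (by omega)
  exact e2.symm'.trans' e1

/-- Starts in the first block of the periodic suffix. -/
lemma Suff.mid1 (h : Suff f n L r c k0 r0) {i : ℕ} (h1 : n - L - r ≤ i) (h2 : i < n - L - r + c) :
    (NewW f n i (n - L - r + c + (r - r0))).card ≤ max (n - r - i) (r - r0) := by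
  have a1 := h.hL
  have a2 := h.hk0
  have a3 := h.hc
  have a4 := h.hrn
  have a5 := h.hr0r
  have a6 := h.hcr0
  by_cases hall : ∀ k, Rpt f n i k → k ≤ n - r - i
  · exact le_trans (card_NewW_le_of_rep hall) (le_max_left _ _)
  · push Not at hall
    obtain ⟨k, hk, hlt⟩ := hall
    obtain ⟨M, D, hM, hD, hn, he, hmax⟩ := exists_max_rep (f := f) (n := n) (i := i) ⟨k, by omega, hk⟩
    have hkM := hmax k hk
    have := h.b2 (j := i) (k := M) (D := D) (by omega) (by omega) hD hn he
    have hD2 : D + r0 ≤ r := by omega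
    refine le_trans (card_NewW_le_shift hmax hD (by omega) hn he) (le_trans ?_ (le_max_right _ _))
    omega

lemma Suff.mid2 (h : Suff f n L r c k0 r0) {i : ℕ} (x : ℕ)
    (h2 : i < n - L - r + c + (r - r0)) :
    (NewW f n i x).card ≤ n - r0 - i := by
  have a1 := h.hL
  have a2 := h.hk0
  have a3 := h.hc
  have a4 := h.hrn
  have a5 := h.hr0r
  have a6 := h.hcr0
  apply card_NewW_le_of_rep
  rintro k ⟨D, hD, hn, he⟩
  by_contra hlt
  apply h.r0min (r0 - D) (by omega) (by omega)
  have e2 := he.sub' (n - k0 - r0) (n - k0 - (r0 - D)) k0 (by omega) (by omega) (by omega)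
  exact e2.symm'.trans' h.r0eq

lemma Suff.mid3 (h : Suff f n L r c k0 r0) {i : ℕ} (h1 : n - L - r + c + (r - r0) ≤ i)
    (h2 : i < n - L - r + r) :
    2 * (NewW f n i (n - L - r + r + c + (r - r0))).card ≤ L + r - c := by
  have a1 := h.hL
  have a2 := h.hk0
  have a3 := h.hc
  have a4 := h.hrn
  have a5 := h.hr0r
  have a6 := h.hcr0
  by_cases hex : ∃ k, 1 ≤ k ∧ Rpt f n i k
  · obtain ⟨M, D, hM, hD, hn, he, hmax⟩ := exists_max_rep hex
    have c1 := card_NewW_le_of_rep (x := n - L - r + r + c + (r - r0)) hmax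
    by_cases hx : i + D < n - L - r + r + c + (r - r0)
    · have c2 := card_NewW_le_shift hmax hD hx hn he
      omega
    · omega
  · have c1 := card_NewW_le_of_rep (f := f) (n := n) (i := i) (m := 0)
      (x := n - L - r + r + c + (r - r0)) ?_
    · omega
    · intro k hk
      by_contra hk0
      exact hex ⟨k, by omega, hk⟩

set_option maxHeartbeats 1000000 in
lemma Suff.early (h : Suff f n L r c k0 r0) {L' r' c' k0' r0' : ℕ}
    (h' : Pref f n L' r' c' k0' r0') (hi : 2 * c' ≤ c + r) (hii : n + r' ≤ c + 2 * r + L' + 1)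
    {i : ℕ} (h1 : i < n - L - r) :
    2 * (NewW f n i n).card ≤ c + r := by
  have a1 := h.hL
  have a2 := h.hk0
  have a3 := h.hc
  have a4 := h.hrn
  have a5 := h.hr0r
  have a6 := h.hcr0
  have b1 := h'.hL
  have b2 := h'.hk0
  have b3 := h'.hc
  have b4 := h'.hrn
  have b5 := h'.hr0r
  have b6 := h'.hcr0
  have h1x : i + L + r < n := by omega
  clear h1
  have hiL : i < L' := by omega
  have hrep : Rpt f n i (L' - i) :=
    ⟨r', by omega, by omega, h'.per.sub' i (i + r') (L' - i) (by omega) (by omega) (by omega)⟩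
  obtain ⟨M, D, hM, hD, hn, he, hmax⟩ := exists_max_rep ⟨L' - i, by omega, hrep⟩
  have hML : L' ≤ i + M := by
    have := hmax _ hrep
    omega
  have c1 := card_NewW_le_of_rep (x := n) hmax
  have c2 := card_NewW_le_shift (x := n) hmax hD (by omega) hn he
  by_cases hα : n ≤ i + M + r
  · rcases h.b2 (j := i) (k := M) (D := D) (by omega) hα hD hn he with hDr | hDr
    · exfalso
      apply h.hmx r (by omega) (by omega)
      exact he.sub' _ _ (L + 1) (by omega) (by omega) (by omega)
    · omega
  by_cases hβ : i + M = L'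
  · obtain ⟨d1, hd1, hdL, hde⟩ := h'.k1
    by_cases hik : i < k0' - 1
    · have c3 := card_NewW_le_of_short (x := n) (k1 := k0' - 1 - i) (d1 := d1) hmax hD (by omega) hn he hd1
        (by omega) (hde.sub' i (i + d1) _ (by omega) (by omega) (by omega))
      omega
    · omega
  have hMlt : L' < i + M := lt_of_le_of_ne hML (Ne.symm hβ)
  clear hβ hML hrep
  have hαx : i + M + r < n := by omega
  clear hα
  have hne : D ≠ r' := by
    intro hDr
    subst hDr
    apply h'.hmx D hD (by omega)
    intro t ht
    by_cases htL : t < L'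
    · exact h'.per t htL
    · exact he.at' _ _ (by omega) (by omega) (by omega)
  rcases Nat.lt_or_gt_of_ne hne with hlt | hgt
  · clear hne
    obtain ⟨e, rfl⟩ := Nat.exists_eq_add_of_lt hlt
    by_cases hq : e + 1 < L' - i
    · have hq2 : i + e + 1 < L' := by omega
      have c3 := card_NewW_le_of_short (x := n) (k1 := L' - i - (e + 1)) (d1 := e + 1) hmax hD
        (by omega) hn he (by omega) (by omega) (by
          clear c1 c2
          intro t ht
          have ht2 : i + t + (e + 1) < L' := by omega
          clear ht hq hi hii a1 a2 a3 a4 a5 a6 b1 b2 b3 b4 b5 b6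
          have e1 := h'.per.at' (i + t) (i + t + (D + e + 1)) (by omega) (by omega) (by omega)
          have e2 := he.at' (i + (e + 1) + t) (i + t + (D + e + 1)) (by omega) (by omega) (by omega)
          rw [e1, e2])
      clear hq a1 a2 a3 a4 a5 a6 b1 b2 b3 b4 b5 b6
      omega
    · clear a1 a2 a3 a4 a5 a6 b1 b2 b3 b4 b5 b6
      omega
  · clear hne
    obtain ⟨e, rfl⟩ := Nat.exists_eq_add_of_lt hgt
    by_cases hq : e + 1 < L' - i
    · have hq2 : i + e + 1 < L' := by omega
      have c3 := card_NewW_le_of_short (x := n) (k1 := L' - i - (e + 1)) (d1 := e + 1) hmax hD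
        (by omega) hn he (by omega) (by omega) (by
          clear c1 c2
          intro t ht
          have ht2 : i + t + (e + 1) < L' := by omega
          clear ht hq hi hii a1 a2 a3 a4 a5 a6 b1 b2 b3 b4 b5 b6
          have e1 := he.at' (i + t) (i + t + (r' + e + 1)) (by omega) (by omega) (by omega)
          have e2 := h'.per.at' (i + (e + 1) + t) (i + t + (r' + e + 1)) (by omega) (by omega) (by omega)
          rw [e1, e2])
      clear hq
      have : (NewW f n i n).card + L' + r' ≤ n := by
        clear a1 a2 a3 a4 a5 a6 b1 b2 b3 b4 b5 b6 hi hii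
        omega
      clear c1 c2 c3
      omega
    · have : (NewW f n i n).card + L' + r' ≤ n := by
        clear a1 a2 a3 a4 a5 a6 b1 b2 b3 b4 b5 b6 hi hii
        omega
      clear c1 c2 hq
      omega

/-- Every closed factor has a representative in `Q`. -/
def Cover (f : ℕ → β) (n : ℕ) (Q : Finset (ℕ × ℕ)) : Prop :=
  ∀ i l, ClosedAt f n i l → ∃ j, (j, l) ∈ Q ∧ j + l ≤ n ∧ Eqv f i j l

/-- Exclusion threshold. -/
def thr (n L r c r0 i : ℕ) : ℕ :=
  if i < n - L - r then n
  else if i < n - L - r + c + (r - r0) then n - L - r + c + (r - r0)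
  else n - L - r + r + c + (r - r0)

lemma exists_max_of_bdd {P : ℕ → Prop} {b : ℕ} (hb : ∀ j, P j → j ≤ b) (h : ∃ j, P j) :
    ∃ m, P m ∧ ∀ j, P j → j ≤ m := by
  classical
  obtain ⟨j, hj⟩ := h
  exact ⟨Nat.findGreatest P b, Nat.findGreatest_spec (hb j hj) hj,
    fun k hk => Nat.le_findGreatest (hb k hk) hk⟩

lemma Suff.cover_aux (h : Suff f n L r c k0 r0) {i l : ℕ} (hcl : ClosedAt f n i l) :
    ∃ j, j < n - L - r + r ∧ l ∈ NewW f n j (thr n L r c r0 j) ∧ j + l ≤ n ∧ Eqv f i j l := by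
  classical
  have a1 := h.hL
  have a2 := h.hk0
  have a3 := h.hc
  have a4 := h.hrn
  have a5 := h.hr0r
  have a6 := h.hcr0
  set P : ℕ → Prop := fun j => j + l ≤ n ∧ Eqv f i j l with hP
  have hPi : P i := ⟨hcl.1, fun t _ => rfl⟩
  by_cases hA : ∃ j, P j ∧ n - L - r ≤ j
  · by_cases hB : ∃ j, P j ∧ n - L - r ≤ j ∧ j < n - L - r + c + (r - r0)
    · obtain ⟨m, ⟨hm1, hm2, hm3⟩, hmax⟩ := exists_max_of_bdd (b := n) (fun j hj => by
        have := hj.1.1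
        omega) hB
      refine ⟨m, by omega, mem_NewW.2 ⟨hcl.shift hm1.1 hm1.2, ?_⟩, hm1.1, hm1.2⟩
      rintro ⟨j, hj1, hj2, hj3, hj4⟩
      rw [thr, if_neg (by omega), if_pos hm3] at hj2
      have := hmax j ⟨⟨hj3, hm1.2.trans' hj4⟩, by omega, hj2⟩
      omega
    · have hC : ∃ j, P j ∧ n - L - r ≤ j ∧ j < n - L - r + r := by
        refine ⟨Nat.find hA, (Nat.find_spec hA).1, (Nat.find_spec hA).2, ?_⟩
        by_contra hlt
        obtain ⟨hm1, hm2⟩ := Nat.find_spec hA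
        have hmin := Nat.find_min hA (m := Nat.find hA - r) (by omega)
        apply hmin
        refine ⟨⟨by have := hm1.1; omega, hm1.2.trans' ?_⟩, by omega⟩
        have := h.periodE (j := Nat.find hA - r) (m := l) (by omega) (by have := hm1.1; omega)
        rw [show Nat.find hA - r + r = Nat.find hA by omega] at this
        exact this.symm'
      obtain ⟨m, ⟨hm1, hm2, hm3⟩, hmax⟩ := exists_max_of_bdd (b := n) (fun j hj => by
        have := hj.1.1
        omega) hC
      have hm4 : ¬ m < n - L - r + c + (r - r0) := fun hlt => hB ⟨m, hm1, hm2, hlt⟩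
      refine ⟨m, hm3, mem_NewW.2 ⟨hcl.shift hm1.1 hm1.2, ?_⟩, hm1.1, hm1.2⟩
      rintro ⟨j, hj1, hj2, hj3, hj4⟩
      rw [thr, if_neg (by omega), if_neg hm4] at hj2
      by_cases hjr : j < n - L - r + r
      · have := hmax j ⟨⟨hj3, hm1.2.trans' hj4⟩, by omega, hjr⟩
        omega
      · apply hB
        refine ⟨j - r, ⟨by omega, (hm1.2.trans' hj4).trans' ?_⟩, by omega, by omega⟩
        have := h.periodE (j := j - r) (m := l) (by omega) (by omega)
        rw [show j - r + r = j by omega] at this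
        exact this.symm'
  · obtain ⟨m, hm1, hmax⟩ := exists_max_of_bdd (P := P) (b := n) (fun j hj => by
        have := hj.1
        omega) ⟨i, hPi⟩
    have hm2 : m < n - L - r := by
      by_contra hlt
      exact hA ⟨m, hm1, by omega⟩
    refine ⟨m, by omega, mem_NewW.2 ⟨hcl.shift hm1.1 hm1.2, ?_⟩, hm1.1, hm1.2⟩
    rintro ⟨j, hj1, hj2, hj3, hj4⟩
    have := hmax j ⟨hj3, hm1.2.trans' hj4⟩
    omega

lemma sum_tri (c m : ℕ) : 2 * ∑ t ∈ Finset.range c, (m - t) ≤ m * (m + 1) := by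
  induction c generalizing m with
  | zero => simp
  | succ c ih =>
    rw [Finset.sum_range_succ']
    cases m with
    | zero => simp
    | succ m =>
      have := ih m
      have e : ∑ k ∈ Finset.range c, (m + 1 - (k + 1)) = ∑ k ∈ Finset.range c, (m - k) :=
        Finset.sum_congr rfl (fun k _ => by omega)
      rw [e]
      simp only [Nat.sub_zero]
      nlinarith

/-- descending sum, exact -/
lemma sum_desc (c a : ℕ) : 2 * ∑ t ∈ Finset.range c, (a + 1 + t) = c * (2 * a + 1 + c) := by
  induction c with
  | zero => simp
  | succ c ih =>
    rw [Finset.sum_range_succ, mul_add, ih]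
    ring

lemma sum_first (c κ δ : ℕ) : 2 * ∑ t ∈ Finset.range c, max (κ + 1 + t) δ ≤
    c * (2 * κ + 1 + c) + (δ - κ - 1) * (δ - κ - 1 + 1) := by
  rw [← sum_desc]
  have := sum_tri c (δ - κ - 1)
  have e : ∑ t ∈ Finset.range c, max (κ + 1 + t) δ =
      ∑ t ∈ Finset.range c, (κ + 1 + t) + ∑ t ∈ Finset.range c, (δ - κ - 1 - t) := by
    rw [← Finset.sum_add_distrib]
    exact Finset.sum_congr rfl (fun k _ => by omega)
  rw [e, mul_add]
  omega

lemma arith_mid (κ δ r0 : ℕ) (h1 : δ ≤ r0) (h2 : κ + 1 ≤ r0) :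
    (δ - κ - 1) * (δ - κ - 1 + 1) + δ * (2 * κ + 1 + δ) ≤ δ * (κ + r0 + δ) := by
  by_cases h : κ + 1 ≤ δ
  · obtain ⟨e, rfl⟩ := Nat.exists_eq_add_of_le h
    obtain ⟨g, rfl⟩ := Nat.exists_eq_add_of_le h1
    rw [show κ + 1 + e - κ - 1 = e by omega]
    nlinarith [Nat.zero_le (κ * e), Nat.zero_le (κ * g), Nat.zero_le (e * g)]
  · rw [show δ - κ - 1 = 0 by omega]
    nlinarith [Nat.mul_le_mul_left δ h2]

lemma arith_final (c x y s : ℕ) (h : x + y + s + 1 ≤ c) :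
    3 * (s * (2 * c + y) + (c * (2 * x + 1 + c) + y * (c + x + y))) ≤
      (2 * c + x + y + s) ^ 2 + (2 * c + x + y + s) := by
  obtain ⟨e, rfl⟩ := Nat.exists_eq_add_of_le h
  nlinarith [Nat.zero_le (y * e), Nat.zero_le (e * e)]

theorem Suff.left (h : Suff f n L r c k0 r0) {L' r' c' k0' r0' : ℕ}
    (h' : Pref f n L' r' c' k0' r0') (hi : 2 * c' ≤ c + r) (hii : n + r' ≤ c + 2 * r + L' + 1) :
    ∃ Q, Cover f n Q ∧ 6 * Q.card ≤ n ^ 2 + n := by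
  classical
  have a1 := h.hL
  have a2 := h.hk0
  have a3 := h.hc
  have a4 := h.hrn
  have a5 := h.hr0r
  have a6 := h.hcr0
  refine ⟨(Finset.range (n - L - r + r)).biUnion
    (fun i => (NewW f n i (thr n L r c r0 i)).image (fun l => (i, l))), ?_, ?_⟩
  · intro i l hcl
    obtain ⟨j, hj, hl, h1, h2⟩ := h.cover_aux hcl
    refine ⟨j, ?_, h1, h2⟩
    simp only [Finset.mem_biUnion, Finset.mem_range, Finset.mem_image]
    exact ⟨j, hj, l, hl, rfl⟩
  · obtain ⟨s, hs⟩ : ∃ s, s = n - L - r := ⟨_, rfl⟩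
    obtain ⟨κ, hκ⟩ : ∃ κ, κ = L - c := ⟨_, rfl⟩
    obtain ⟨δ, hδ⟩ : ∃ δ, δ = r - r0 := ⟨_, rfl⟩
    obtain ⟨ε, hε⟩ : ∃ ε, ε = r0 - c := ⟨_, rfl⟩
    have hcard : 2 * ((Finset.range (n - L - r + r)).biUnion
        (fun i => (NewW f n i (thr n L r c r0 i)).image (fun l => (i, l)))).card ≤
        2 * ∑ i ∈ Finset.range (n - L - r + r), (NewW f n i (thr n L r c r0 i)).card := by
      apply Nat.mul_le_mul_left
      refine le_trans Finset.card_biUnion_le (Finset.sum_le_sum fun i _ => Finset.card_image_le)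
    have hrange : n - L - r + r = s + c + δ + ε := by omega
    rw [hrange] at hcard ⊢
    rw [Finset.sum_range_add, Finset.sum_range_add, Finset.sum_range_add] at hcard
    have e1 : 2 * ∑ i ∈ Finset.range s, (NewW f n i (thr n L r c r0 i)).card ≤ s * (c + r) := by
      rw [Finset.mul_sum]
      refine le_trans (Finset.sum_le_card_nsmul _ _ (c + r) ?_) (by simp)
      intro i hi'
      rw [Finset.mem_range] at hi'
      rw [thr, if_pos (by omega)]
      exact h.early h' hi hii (by omega)
    have e2 : 2 * ∑ i ∈ Finset.range c, (NewW f n (s + i) (thr n L r c r0 (s + i))).card ≤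
        c * (2 * κ + 1 + c) + (δ - κ - 1) * (δ - κ - 1 + 1) := by
      refine le_trans (Nat.mul_le_mul_left 2 ?_) (sum_first c κ δ)
      rw [← Finset.sum_range_reflect]
      apply Finset.sum_le_sum
      intro i hi'
      rw [Finset.mem_range] at hi'
      rw [thr, if_neg (by omega), if_pos (by omega)]
      refine le_trans (h.mid1 (by omega) (by omega)) ?_
      omega
    have e3 : 2 * ∑ i ∈ Finset.range δ, (NewW f n (s + c + i) (thr n L r c r0 (s + c + i))).card ≤
        δ * (2 * κ + 1 + δ) := by
      rw [← sum_desc]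
      apply Nat.mul_le_mul_left 2
      rw [← Finset.sum_range_reflect]
      apply Finset.sum_le_sum
      intro i hi'
      rw [Finset.mem_range] at hi'
      refine le_trans (h.mid2 (i := s + c + (δ - 1 - i)) _ (by omega)) ?_
      omega
    have e4 : 2 * ∑ i ∈ Finset.range ε,
        (NewW f n (s + c + δ + i) (thr n L r c r0 (s + c + δ + i))).card ≤ ε * (κ + r) := by
      rw [Finset.mul_sum]
      refine le_trans (Finset.sum_le_card_nsmul _ _ (κ + r) ?_) (by simp)
      intro i hi'
      rw [Finset.mem_range] at hi'
      rw [thr, if_neg (by omega), if_neg (by omega)]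
      refine le_trans (h.mid3 (by omega) (by omega)) ?_
      omega
    have e5 := arith_mid κ δ r0 (by omega) (by omega)
    have e6 := arith_final c κ (δ + ε) s (by omega)
    have hn : 2 * c + κ + (δ + ε) + s = n := by omega
    rw [hn] at e6
    have hr : r = c + ε + δ := by omega
    have hr0 : r0 = c + ε := by omega
    have e7 : δ * (κ + r0 + δ) + ε * (κ + r) = (δ + ε) * (c + κ + (δ + ε)) := by
      rw [hr, hr0]; ring
    have e8 : s * (c + r) = s * (2 * c + (δ + ε)) := by
      rw [hr]; ring
    linarith

end LeftPeel

end Positions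

section Glue

variable [DecidableEq α]

/-- The word as a function on positions. -/
def fn (w : List α) : ℕ → Option α := fun t => w[t]?

lemma take_drop_eq_iff {w v : List α} {i : ℕ} (h : i + v.length ≤ w.length) :
    (w.drop i).take v.length = v ↔ ∀ t < v.length, v[t]? = w[i + t]? := by
  constructor
  · intro he t ht
    conv_lhs => rw [← he]
    rw [List.getElem?_take, if_pos ht, List.getElem?_drop]
  · intro he
    apply List.ext_getElem?
    intro t
    rw [List.getElem?_take]
    split_ifs with ht
    · rw [List.getElem?_drop, he t ht]
    · rw [List.getElem?_eq_none (by omega)]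

lemma factor_iff_occ {w v : List α} :
    v <:+: w ↔ ∃ i, i + v.length ≤ w.length ∧ (w.drop i).take v.length = v := by
  constructor
  · rintro ⟨s, t, rfl⟩
    refine ⟨s.length, by simp, by simp⟩
  · rintro ⟨i, -, he⟩
    rw [← he]
    exact (List.take_prefix _ _).isInfix.trans (List.drop_suffix _ _).isInfix

lemma mem_factors {w v : List α} : v ∈ (w.inits.flatMap List.tails).toFinset ↔ v <:+: w := by
  rw [List.mem_toFinset, List.mem_flatMap]
  constructor
  · rintro ⟨p, hp, hv⟩
    rw [List.mem_inits] at hp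
    rw [List.mem_tails] at hv
    exact hv.isInfix.trans hp.isInfix
  · rintro ⟨s, t, rfl⟩
    exact ⟨s ++ v, by rw [List.mem_inits]; exact List.prefix_append _ _,
      by rw [List.mem_tails]; exact List.suffix_append _ _⟩

lemma eqv_fn_take {v : List α} {k d : ℕ} (hk : k ≤ v.length) (hd : d + k ≤ v.length) :
    (d + (v.take k).length ≤ v.length ∧ (v.drop d).take (v.take k).length = v.take k) ↔
      Eqv (fn v) 0 d k := by
  have hl : (v.take k).length = k := by simp [hk]
  have hb : d + (v.take k).length ≤ v.length := by omega
  rw [take_drop_eq_iff hb]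
  constructor
  · rintro ⟨-, h⟩ t ht
    have := h t (by omega)
    rw [List.getElem?_take, if_pos ht] at this
    simpa [fn] using this
  · intro h
    refine ⟨hb, fun t ht => ?_⟩
    rw [List.getElem?_take, if_pos (by omega)]
    simpa [fn] using h t (by omega)

lemma closedWord_iff (v : List α) :
    ClosedWord v ↔ v.length ≤ 1 ∨ ∃ k, BorderAt (fn v) 0 v.length k := by
  unfold ClosedWord
  apply or_congr Iff.rfl
  have key : ∀ k, 0 < k → k < v.length →
      (((v.take k) <:+ v ∧ occCount (v.take k) v = 2) ↔ BorderAt (fn v) 0 v.length k) := by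
    intro k hk0 hk
    have hl : (v.take k).length = k := by simp [hk.le]
    set S := (Finset.range (v.length + 1)).filter
      (fun i => i + (v.take k).length ≤ v.length ∧
        (v.drop i).take (v.take k).length = v.take k) with hS
    have hmem : ∀ d, d ∈ S ↔ d + k ≤ v.length ∧ Eqv (fn v) 0 d k := by
      intro d
      rw [hS, Finset.mem_filter, Finset.mem_range]
      constructor
      · rintro ⟨-, h⟩
        have hd : d + k ≤ v.length := by have := h.1; omega
        exact ⟨hd, (eqv_fn_take hk.le hd).1 h⟩
      · rintro ⟨hd, h⟩
        exact ⟨by omega, (eqv_fn_take hk.le hd).2 h⟩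
    have hocc : occCount (v.take k) v = S.card := rfl
    have h0 : 0 ∈ S := (hmem 0).2 ⟨by omega, fun t _ => rfl⟩
    have hsuf : (v.take k) <:+ v ↔ v.length - k ∈ S := by
      rw [hmem, List.suffix_iff_eq_drop, hl]
      rw [← eqv_fn_take hk.le (by omega)]
      rw [hl]
      have : (v.drop (v.length - k)).take k = v.drop (v.length - k) := by
        apply List.take_of_length_le
        rw [List.length_drop]; omega
      rw [this]
      constructor
      · intro h
        exact ⟨by omega, by omega, h.symm⟩
      · intro h
        exact h.2.2.symm
    rw [hsuf, hocc]
    constructor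
    · rintro ⟨h1, h2⟩
      refine ⟨hk0, hk, ?_, ?_⟩
      · simpa using ((hmem _).1 h1).2
      · intro d hd hd' hE
        rw [Nat.zero_add] at hE
        have h3 : d ∈ S := (hmem d).2 ⟨by omega, hE⟩
        have : ({0, d, v.length - k} : Finset ℕ) ⊆ S := by
          intro x hx
          simp only [Finset.mem_insert, Finset.mem_singleton] at hx
          rcases hx with rfl | rfl | rfl <;> assumption
        have h4 := Finset.card_le_card this
        rw [Finset.card_eq_three.2 ⟨0, d, v.length - k, by omega, by omega, by omega, rfl⟩] at h4
        omega
    · rintro ⟨-, -, h3, h4⟩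
      have h1 : v.length - k ∈ S := (hmem _).2 ⟨by omega, by simpa using h3⟩
      refine ⟨h1, ?_⟩
      have : S = {0, v.length - k} := by
        ext d
        rw [Finset.mem_insert, Finset.mem_singleton]
        constructor
        · intro hd
          obtain ⟨hd1, hd2⟩ := (hmem d).1 hd
          by_contra hne
          exact h4 d (by omega) (by omega) (by simpa using hd2)
        · rintro (rfl | rfl) <;> assumption
      rw [this, Finset.card_pair (by omega)]
  constructor
  · rintro ⟨k, hk, h⟩
    rw [Finset.mem_Ioo] at hk
    exact ⟨k, (key k hk.1 hk.2).1 h⟩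
  · rintro ⟨k, h⟩
    have h1 := h.1
    have h2 := h.2.1
    exact ⟨k, Finset.mem_Ioo.2 ⟨by omega, h2⟩, (key k (by omega) h2).2 h⟩

/-- The set counted by `clCount'`. -/
def cset (w : List α) : Finset (List α) := (closedFactors w).filter (fun u => 2 ≤ u.length)

lemma mem_cset {w v : List α} : v ∈ cset w ↔
    v <:+: w ∧ ∃ k, BorderAt (fn v) 0 v.length k := by
  rw [cset, closedFactors, Finset.mem_filter, Finset.mem_filter, mem_factors, closedWord_iff]
  constructor
  · rintro ⟨⟨h1, h2⟩, h3⟩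
    exact ⟨h1, h2.resolve_left (by omega)⟩
  · rintro ⟨h1, k, hk⟩
    refine ⟨⟨h1, Or.inr ⟨k, hk⟩⟩, ?_⟩
    have := hk.1
    have := hk.2.1
    omega

lemma fn_reverse (w : List α) : ∀ t < w.length, fn w.reverse t = fn w (w.length - 1 - t) := by
  intro t ht
  exact List.getElem?_reverse ht

lemma border_reverse {v : List α} {k : ℕ} (h : BorderAt (fn v) 0 v.length k) :
    BorderAt (fn v.reverse) 0 v.reverse.length k := by
  rw [List.length_reverse]
  obtain ⟨h1, h2, h3, h4⟩ := h
  rw [Nat.zero_add] at h3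
  refine ⟨h1, h2, ?_, ?_⟩
  · rw [eqv_reverse (fn_reverse v) (by omega) (by omega)]
    have := h3.symm'
    convert this using 1 <;> omega
  · intro d hd hd' hE
    rw [eqv_reverse (fn_reverse v) (by omega) (by omega)] at hE
    apply h4 (v.length - k - d) (by omega) (by omega)
    rw [Nat.zero_add] at hE ⊢
    rw [Nat.sub_zero] at hE
    exact h3.trans' hE

lemma clCount'_reverse_le (w : List α) : clCount' w ≤ clCount' w.reverse := by
  apply Finset.card_le_card_of_injOn List.reverse
  · intro v hv
    have hv' : v ∈ cset w := hv
    show v.reverse ∈ cset w.reverse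
    rw [mem_cset] at hv' ⊢
    obtain ⟨h1, k, hk⟩ := hv'
    exact ⟨by simpa using h1, k, border_reverse hk⟩
  · exact List.reverse_injective.injOn

lemma clCount'_reverse (w : List α) : clCount' w.reverse = clCount' w := by
  apply le_antisymm
  · have := clCount'_reverse_le w.reverse
    rwa [List.reverse_reverse] at this
  · exact clCount'_reverse_le w

lemma eqv_of_occ {w v : List α} {i : ℕ} (h : i + v.length ≤ w.length)
    (ho : (w.drop i).take v.length = v) {a b k : ℕ} (ha : a + k ≤ v.length)
    (hb : b + k ≤ v.length) : Eqv (fn v) a b k ↔ Eqv (fn w) (i + a) (i + b) k := by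
  rw [take_drop_eq_iff h] at ho
  have key : ∀ t < v.length, fn v t = fn w (i + t) := ho
  constructor
  · intro hE t ht
    have := hE t ht
    rw [key _ (by omega), key _ (by omega)] at this
    rwa [Nat.add_assoc, Nat.add_assoc]
  · intro hE t ht
    rw [key _ (by omega), key _ (by omega)]
    have := hE t ht
    rwa [Nat.add_assoc, Nat.add_assoc] at this

lemma closedAt_of_occ {w v : List α} {i : ℕ} (h : i + v.length ≤ w.length)
    (ho : (w.drop i).take v.length = v) {k : ℕ} (hb : BorderAt (fn v) 0 v.length k) :
    ClosedAt (fn w) w.length i v.length := by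
  obtain ⟨h1, h2, h3, h4⟩ := hb
  refine ⟨h, k, h1, h2, ?_, ?_⟩
  · have := (eqv_of_occ h ho (by omega) (by omega)).1 h3
    simpa using this
  · intro d hd hd' hE
    apply h4 d hd hd'
    apply (eqv_of_occ h ho (by omega) (by omega)).2
    simpa using hE

lemma occ_of_eqv {w v : List α} {i j : ℕ} (h : i + v.length ≤ w.length)
    (ho : (w.drop i).take v.length = v) (hj : j + v.length ≤ w.length)
    (he : Eqv (fn w) i j v.length) : (w.drop j).take v.length = v := by
  rw [take_drop_eq_iff h] at ho
  rw [take_drop_eq_iff hj]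
  intro t ht
  rw [ho t ht]
  exact he t ht

lemma glue_cover {w : List α} {Q : Finset (ℕ × ℕ)} (hQ : Cover (fn w) w.length Q) :
    clCount' w ≤ Q.card := by
  have : cset w ⊆ Q.image (fun p => (w.drop p.1).take p.2) := by
    intro v hv
    obtain ⟨h1, k, hk⟩ := mem_cset.1 hv
    obtain ⟨i, hi, ho⟩ := factor_iff_occ.1 h1
    obtain ⟨j, hjQ, hj, he⟩ := hQ i v.length (closedAt_of_occ hi ho hk)
    rw [Finset.mem_image]
    exact ⟨(j, v.length), hjQ, occ_of_eqv hi ho hj he⟩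
  exact le_trans (Finset.card_le_card this) Finset.card_image_le

lemma glue_new (w : List α) :
    clCount' w ≤ clCount' (w.drop 1) + (NewW (fn w) w.length 0 w.length).card := by
  have : cset w ⊆ cset (w.drop 1) ∪
      (NewW (fn w) w.length 0 w.length).image (fun l => w.take l) := by
    intro v hv
    obtain ⟨h1, k, hk⟩ := mem_cset.1 hv
    obtain ⟨i, hi, ho⟩ := factor_iff_occ.1 h1
    have hk1 := hk.1
    have hk2 := hk.2.1
    rw [Finset.mem_union]
    by_cases hex : ∃ j, 0 < j ∧ j + v.length ≤ w.length ∧ (w.drop j).take v.length = v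
    · left
      obtain ⟨j, hj0, hj, hjo⟩ := hex
      rw [mem_cset]
      refine ⟨factor_iff_occ.2 ⟨j - 1, ?_, ?_⟩, k, hk⟩
      · rw [List.length_drop]; omega
      · rw [List.drop_drop, show 1 + (j - 1) = j by omega]
        exact hjo
    · right
      have hi0 : i = 0 := by
        by_contra hne
        exact hex ⟨i, by omega, hi, ho⟩
      subst hi0
      rw [Finset.mem_image]
      refine ⟨v.length, mem_NewW.2 ⟨closedAt_of_occ hi ho hk, ?_⟩, by simpa using ho⟩
      rintro ⟨j, hj0, -, hj, he⟩
      exact hex ⟨j, hj0, hj, occ_of_eqv hi ho hj he⟩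
  calc clCount' w = (cset w).card := rfl
    _ ≤ _ := Finset.card_le_card this
    _ ≤ _ := Finset.card_union_le _ _
    _ ≤ _ := Nat.add_le_add_left Finset.card_image_le _

end Glue

/-- if cl'(w) - cl'(w⁻) > n/3 and cl'(w) - cl'(⁻w) > n/3 (where w⁻, ⁻w
are the prefix and suffix of length n-1), then cl'(w) ≤ n²/6 + n/6. -/
theorem stmt18 [DecidableEq α] (w : List α)
    (h1 : 3 * clCount' w.dropLast + w.length < 3 * clCount' w)
    (h2 : 3 * clCount' (w.drop 1) + w.length < 3 * clCount' w) :
    6 * clCount' w ≤ w.length ^ 2 + w.length := by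
  have g1 := glue_new w
  have g2 := glue_new w.reverse
  have hrd : w.reverse.drop 1 = w.dropLast.reverse := by
    rw [List.drop_one, List.tail_reverse]
  rw [hrd, clCount'_reverse, clCount'_reverse, List.length_reverse] at g2
  obtain ⟨L', r', c', k0', r0', hp⟩ :=
    exists_pref (f := fn w) (n := w.length) (by omega)
  obtain ⟨L, r, c, k0, r0, hq⟩ :=
    exists_pref (f := fn w.reverse) (n := w.length) (by omega)
  have hs : Suff (fn w) w.length L r c k0 r0 := hq.reverse (fn_reverse w)
  have hs' : Suff (fn w.reverse) w.length L' r' c' k0' r0' := by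
    apply hp.reverse
    intro t ht
    rw [fn_reverse w _ (by omega)]
    congr 1
    omega
  have hdich : (2 * c' ≤ c + r ∧ w.length + r' ≤ c + 2 * r + L' + 1) ∨
      (2 * c ≤ c' + r' ∧ w.length + r ≤ c' + 2 * r' + L + 1) := by
    have a1 := hq.hL
    have a2 := hq.hk0
    have a3 := hq.hc
    have a4 := hq.hrn
    have a5 := hq.hr0r
    have a6 := hq.hcr0
    have b1 := hp.hL
    have b2 := hp.hk0
    have b3 := hp.hc
    have b4 := hp.hrn
    have b5 := hp.hr0r
    have b6 := hp.hcr0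
    clear g1 g2 h1 h2
    omega
  rcases hdich with ⟨hi, hii⟩ | ⟨hi, hii⟩
  · obtain ⟨Q, hQ, hcard⟩ := hs.left hp hi hii
    have := glue_cover hQ
    omega
  · obtain ⟨Q, hQ, hcard⟩ := hs'.left hq hi hii
    rw [← List.length_reverse (as := w)] at hQ
    have := glue_cover hQ
    rw [clCount'_reverse] at this
    omega
end
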